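/- For every integer k ≥ 2 and every nonnegative integer n, the number of anti-lecture hall compositions of weight n with first entry at most 2k−1 satisfies |F_{2k−1}(n)| = Σ_{j=0}^{n} d(j) · |Q_{2k−2}(n−j)|, where d(j) denotes the number of partitions of j into distinct parts (with d(0) = 1). -/

import Mathlib

/-- `f : ℕ → ℕ` (with `f i` standing for `λ_{i+1}`) is an anti-lecture hall composition:
finitely many nonzero entries and `λ₁/1 ≥ λ₂/2 ≥ λ₃/3 ≥ ⋯ ≥ 0`, i.e.
`(i+1)·λ_i ≥ i·λ_{i+1}` for all `i ≥ 1`. -/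
def IsALH (f : ℕ → ℕ) : Prop :=
  (Function.support f).Finite ∧ ∀ i : ℕ, (i + 1) * f (i + 1) ≤ (i + 2) * f i

/-- The weight `|λ| = λ₁ + λ₂ + ⋯` of a composition. -/
noncomputable def wt (f : ℕ → ℕ) : ℕ := ∑ᶠ i, f i

/-- `F k n`: anti-lecture hall compositions of weight `n` whose first entry is at most `k`. -/
def Fset (k n : ℕ) : Set (ℕ → ℕ) := {f | IsALH f ∧ f 0 ≤ k ∧ wt f = n}

/-- `Q k n`: anti-lecture hall compositions `λ` of weight `n` with `λ₁ ≤ k` and `⌊λ_i/i⌋` even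
for every `i ≥ 1`. -/
def Qset (k n : ℕ) : Set (ℕ → ℕ) :=
  {f | IsALH f ∧ f 0 ≤ k ∧ (∀ i, Even (f i / (i + 1))) ∧ wt f = n}

open Finset Polynomial

/-- The `q`-Pochhammer symbol `(q; q)_n = ∏_{i=1}^n (1 - q^i)`. -/
noncomputable def qPoch (n : ℕ) : ℤ[X] := ∏ i ∈ range n, (1 - X ^ (i + 1))

/-- The triangular number `1 + 2 + ⋯ + n`. -/
def tri (n : ℕ) : ℕ := ∑ i ∈ range n, (i + 1)

/-- The Gaussian binomial coefficient `[a + b choose b]`. -/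
noncomputable def gaussBinom : ℕ → ℕ → ℤ[X]
  | 0, _ => 1
  | _ + 1, 0 => 1
  | a + 1, b + 1 => gaussBinom (a + 1) b + X ^ (b + 1) * gaussBinom a (b + 1)

/-- The polynomial `∏_{i=1}^n (1 + q^i)`. -/
noncomputable def distinctGF (n : ℕ) : ℤ[X] := ∏ i ∈ range n, (1 + X ^ (i + 1))

theorem qPoch_succ (n : ℕ) : qPoch (n + 1) = qPoch n * (1 - X ^ (n + 1)) :=
  prod_range_succ _ _

theorem qPoch_ne_zero (n : ℕ) : qPoch n ≠ 0 := by
  refine prod_ne_zero_iff.mpr fun i _ h => ?_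
  simpa using congrArg (eval 0) h

theorem tri_succ (n : ℕ) : tri (n + 1) = tri n + (n + 1) := sum_range_succ _ _

theorem tri_add (a b : ℕ) : tri (a + b) = tri a + a * b + tri b := by
  induction b with
  | zero => simp [tri]
  | succ b ih => rw [← add_assoc, tri_succ, ih, tri_succ]; ring

@[simp] theorem gaussBinom_zero_left (b : ℕ) : gaussBinom 0 b = 1 := by rw [gaussBinom]

@[simp] theorem gaussBinom_zero_right (a : ℕ) : gaussBinom a 0 = 1 := by
  cases a <;> simp [gaussBinom]

theorem gaussBinom_succ_succ (a b : ℕ) :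
    gaussBinom (a + 1) (b + 1) = gaussBinom (a + 1) b + X ^ (b + 1) * gaussBinom a (b + 1) := by
  rw [gaussBinom]

theorem gaussBinom_mul_qPoch (a b : ℕ) : gaussBinom a b * (qPoch a * qPoch b) = qPoch (a + b) := by
  induction a generalizing b with
  | zero => simp [qPoch]
  | succ a iha =>
    induction b with
    | zero => simp [qPoch]
    | succ b ihb =>
      have h := iha (b + 1)
      rw [show a + (b + 1) = a + 1 + b by ring] at h
      rw [gaussBinom_succ_succ, ← add_assoc, qPoch_succ (a + 1 + b)]
      rw [show (gaussBinom (a + 1) b + X ^ (b + 1) * gaussBinom a (b + 1)) *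
        (qPoch (a + 1) * qPoch (b + 1)) =
          gaussBinom (a + 1) b * (qPoch (a + 1) * qPoch b) * (1 - X ^ (b + 1)) +
          gaussBinom a (b + 1) * (qPoch a * qPoch (b + 1)) * (X ^ (b + 1) * (1 - X ^ (a + 1))) by
        rw [qPoch_succ a, qPoch_succ b]; ring]
      rw [h, ihb]; ring

theorem gaussBinom_comm (a b : ℕ) : gaussBinom a b = gaussBinom b a := by
  apply mul_right_cancel₀ (mul_ne_zero (qPoch_ne_zero a) (qPoch_ne_zero b))
  rw [gaussBinom_mul_qPoch, mul_comm (qPoch a), gaussBinom_mul_qPoch, add_comm]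

theorem gaussBinom_succ_succ' (a b : ℕ) :
    gaussBinom (a + 1) (b + 1) = gaussBinom a (b + 1) + X ^ (a + 1) * gaussBinom (a + 1) b := by
  rw [gaussBinom_comm, gaussBinom_succ_succ, gaussBinom_comm _ a, gaussBinom_comm b]

theorem gaussBinom_mul_gaussBinom (a b r : ℕ) :
    gaussBinom a (r + b) * gaussBinom b r = gaussBinom (b + a) r * gaussBinom a b := by
  have h : qPoch a * qPoch b * qPoch r * (qPoch (r + b) * qPoch (b + a)) ≠ 0 := by
    simp [qPoch_ne_zero]
  apply mul_right_cancel₀ h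
  calc _ = (gaussBinom a (r + b) * (qPoch a * qPoch (r + b))) *
        (gaussBinom b r * (qPoch b * qPoch r)) * qPoch (b + a) := by ring
    _ = (gaussBinom (b + a) r * (qPoch (b + a) * qPoch r)) *
        (gaussBinom a b * (qPoch a * qPoch b)) * qPoch (r + b) := by
      simp only [gaussBinom_mul_qPoch]
      rw [show a + (r + b) = b + a + r by ring, add_comm a b, add_comm b r]; ring
    _ = _ := by ring

/-- The `q`-binomial theorem. -/
theorem sum_gaussBinom (z : ℤ[X]) (m : ℕ) :
    ∑ p ∈ antidiagonal m, X ^ tri p.1 * z ^ p.1 * gaussBinom p.2 p.1 =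
      ∏ i ∈ range m, (1 + z * X ^ (i + 1)) := by
  induction m with
  | zero => simp [tri]
  | succ m ih =>
    rw [prod_range_succ, ← ih, mul_add, mul_one, sum_mul]
    cases m with
    | zero => simp [tri, Nat.sum_antidiagonal_succ]; ring
    | succ m =>
      rw [Nat.sum_antidiagonal_succ, Nat.sum_antidiagonal_succ',
        Nat.sum_antidiagonal_succ (n := m), Nat.sum_antidiagonal_succ' (n := m)]
      have key : ∀ p ∈ antidiagonal m,
          X ^ tri (p.1 + 1) * z ^ (p.1 + 1) * gaussBinom (p.2 + 1) (p.1 + 1) =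
          X ^ tri (p.1 + 1) * z ^ (p.1 + 1) * gaussBinom p.2 (p.1 + 1) +
          X ^ tri p.1 * z ^ p.1 * gaussBinom (p.2 + 1) p.1 * (z * X ^ (m + 1 + 1)) := by
        intro p hp
        rw [HasAntidiagonal.mem_antidiagonal] at hp
        rw [gaussBinom_succ_succ', tri_succ, ← hp]; ring
      dsimp only
      rw [sum_congr rfl key, sum_add_distrib]
      simp only [tri_succ, gaussBinom_zero_left, gaussBinom_zero_right]
      ring

theorem sum_antidiagonal_assoc {M : Type*} [AddCommMonoid M] (n : ℕ) (F : ℕ → ℕ → ℕ → M) :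
    ∑ p ∈ antidiagonal n, ∑ u ∈ antidiagonal p.1, F u.1 u.2 p.2 =
      ∑ p ∈ antidiagonal n, ∑ u ∈ antidiagonal p.2, F p.1 u.1 u.2 := by
  rw [sum_sigma', sum_sigma']
  refine sum_nbij' (fun x => ⟨(x.2.1, x.2.2 + x.1.2), (x.2.2, x.1.2)⟩)
    (fun x => ⟨(x.1.1 + x.2.1, x.2.2), (x.1.1, x.2.1)⟩) ?_ ?_ ?_ ?_
    (fun _ _ => rfl) <;>
  · rintro ⟨⟨a, b⟩, ⟨c, d⟩⟩ h
    simp only [mem_sigma, HasAntidiagonal.mem_antidiagonal] at h ⊢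
    grind

/-- `k`-fold iterates of the operator `f ↦ ∑_r q^{c r(r+1)/2} [n choose r] f(r)`, applied to the
constant sequence `1`. -/
noncomputable def chainGF (c : ℕ) : ℕ → ℕ → ℤ[X]
  | 0, _ => 1
  | k + 1, n => ∑ p ∈ antidiagonal n, X ^ (c * tri p.1) * gaussBinom p.2 p.1 * chainGF c k p.1

theorem chainGF_succ (c k n : ℕ) : chainGF c (k + 1) n =
    ∑ p ∈ antidiagonal n, X ^ (c * tri p.1) * gaussBinom p.2 p.1 * chainGF c k p.1 := rfl

theorem distinctGF_add (r m : ℕ) :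
    distinctGF (r + m) = distinctGF r * ∏ i ∈ range m, (1 + X ^ r * X ^ (i + 1)) := by
  rw [distinctGF, prod_range_add, ← distinctGF]
  simp only [← pow_add, add_assoc]

theorem chainGF_one_eq (k n : ℕ) :
    chainGF 1 (2 * k + 1) n = distinctGF n * chainGF 2 k n := by
  induction k generalizing n with
  | zero =>
    have := sum_gaussBinom 1 n
    simpa [chainGF, distinctGF] using this
  | succ k ih =>
    rw [show 2 * (k + 1) + 1 = 2 * k + 1 + 1 + 1 by ring, chainGF_succ]
    simp only [chainGF_succ 1 (2 * k + 1), ih, mul_sum]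
    have h : ∀ p ∈ antidiagonal n, ∀ u ∈ antidiagonal p.1,
        X ^ (1 * tri p.1) * gaussBinom p.2 p.1 * (X ^ (1 * tri u.1) * gaussBinom u.2 u.1 *
          (distinctGF u.1 * chainGF 2 k u.1)) =
        X ^ (1 * tri (u.1 + u.2)) * gaussBinom p.2 (u.1 + u.2) *
          (X ^ (1 * tri u.1) * gaussBinom u.2 u.1 * (distinctGF u.1 * chainGF 2 k u.1)) := by
      intro p _ u hu
      rw [HasAntidiagonal.mem_antidiagonal.mp hu]
    rw [sum_congr rfl fun p hp => sum_congr rfl (h p hp)]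
    rw [sum_antidiagonal_assoc n fun r b a => X ^ (1 * tri (r + b)) * gaussBinom a (r + b) *
          (X ^ (1 * tri r) * gaussBinom b r * (distinctGF r * chainGF 2 k r))]
    rw [chainGF_succ, mul_sum]
    refine sum_congr rfl fun p hp => ?_
    rw [← HasAntidiagonal.mem_antidiagonal.mp hp, distinctGF_add, ← sum_gaussBinom, mul_sum, sum_mul]
    refine sum_congr rfl fun u hu => ?_
    rw [← HasAntidiagonal.mem_antidiagonal.mp hu]
    have e := gaussBinom_mul_gaussBinom u.2 u.1 p.1
    rw [tri_add]
    linear_combination (X ^ (2 * tri p.1 + p.1 * u.1 + tri u.1) * distinctGF p.1 *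
      chainGF 2 k p.1) * e

theorem coeff_distinctGF {j n : ℕ} (h : j ≤ n) :
    (distinctGF n).coeff j = (Nat.Partition.distincts j).card := by
  have e : distinctGF n = ∏ i ∈ Icc 1 n, (1 + X ^ i) := by
    rw [distinctGF, range_eq_Ico, prod_Ico_add' (fun i => (1 + X ^ i : ℤ[X])) 0 n 1]
    rfl
  have e' (s : Finset ℕ) : ∏ i ∈ s, (X ^ i : ℤ[X]) = X ^ ∑ i ∈ s, i :=
    prod_pow_eq_pow_sum s (fun i => i) X
  simp only [e, prod_one_add, e', finsetSum_coeff, coeff_X_pow]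
  rw [sum_boole, Nat.cast_inj]
  symm
  refine card_bij (fun p _ => p.parts.toFinset) ?_ ?_ ?_
  · intro p hp
    simp only [Nat.Partition.distincts, mem_filter, mem_univ, true_and] at hp
    simp only [mem_filter, mem_powerset]
    refine ⟨fun i hi => ?_, ?_⟩
    · rw [Multiset.mem_toFinset] at hi
      have h1 := p.parts_pos hi
      have h2 := Multiset.le_sum_of_mem hi
      rw [p.parts_sum] at h2
      rw [mem_Icc]; omega
    · rw [Finset.sum_eq_multiset_sum, Multiset.toFinset_val, Multiset.dedup_eq_self.mpr hp,
        Multiset.map_id', p.parts_sum]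
  · intro p hp p' hp' h
    simp only [Nat.Partition.distincts, mem_filter, mem_univ, true_and] at hp hp'
    ext1
    have := congrArg Finset.val h
    simpa [Multiset.toFinset_val, Multiset.dedup_eq_self.mpr hp, Multiset.dedup_eq_self.mpr hp']
      using this
  · intro s hs
    simp only [mem_filter, mem_powerset] at hs
    refine ⟨⟨s.val, fun {i} hi => (mem_Icc.mp (hs.1 hi)).1, ?_⟩, ?_, ?_⟩
    · rw [hs.2, Finset.sum_eq_multiset_sum, Multiset.map_id']
    · simp [Nat.Partition.distincts, s.nodup]
    · simp

theorem finite_bounded_support (N M : ℕ) :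
    {f : ℕ → ℕ | (∀ i, N ≤ i → f i = 0) ∧ ∀ i, f i ≤ M}.Finite := by
  refine ((Set.Finite.pi' fun _ : Fin N => Set.finite_Iic M).image
    fun g i => if h : i < N then g ⟨i, h⟩ else 0).subset ?_
  rintro f ⟨h0, hM⟩
  refine ⟨fun i => f i, fun i => hM i, funext fun i => ?_⟩
  by_cases h : i < N
  · simp [h]
  · simp [h, h0 i (not_lt.mp h)]

theorem tailSet_finite (m r : ℕ) :
    {h : ℕ → ℕ | (∀ i, m ≤ i → h i = 0) ∧ (∀ i, h (i + 1) ≤ h i) ∧ h 0 ≤ r}.Finite :=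
  (finite_bounded_support m r).subset fun _ ⟨h0, h1, h2⟩ =>
    ⟨h0, fun i => (antitone_nat_of_succ_le h1 (Nat.zero_le i)).trans h2⟩

/-- Weakly decreasing sequences of length `m` with entries at most `r`. -/
noncomputable def tailSet (m r : ℕ) : Finset (ℕ → ℕ) := (tailSet_finite m r).toFinset

theorem mem_tailSet {m r : ℕ} {h : ℕ → ℕ} :
    h ∈ tailSet m r ↔ (∀ i, m ≤ i → h i = 0) ∧ (∀ i, h (i + 1) ≤ h i) ∧ h 0 ≤ r := by
  simp [tailSet]

theorem le_of_anti_lecture {f : ℕ → ℕ} (hf : ∀ i, (i + 1) * f (i + 1) ≤ (i + 2) * f i) (i : ℕ) :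
    f i ≤ (i + 1) * f 0 := by
  induction i with
  | zero => simp
  | succ i ih =>
    refine le_of_mul_le_mul_left ((hf i).trans ?_) (Nat.succ_pos i)
    calc (i + 2) * f i ≤ (i + 2) * ((i + 1) * f 0) := by gcongr
      _ = _ := by ring

theorem alhSet_finite (c k N : ℕ) :
    {f : ℕ → ℕ | (∀ i, N ≤ i → f i = 0) ∧ (∀ i, (i + 1) * f (i + 1) ≤ (i + 2) * f i) ∧
      f 0 ≤ c * k ∧ ∀ i, c ∣ f i / (i + 1)}.Finite := by
  refine (finite_bounded_support N (N * (c * k))).subset fun f ⟨h0, h1, h2, _⟩ => ⟨h0, fun i => ?_⟩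
  rcases lt_or_ge i N with h | h
  · exact (le_of_anti_lecture h1 i).trans (Nat.mul_le_mul h h2)
  · simp [h0 i h]

/-- Anti-lecture hall compositions of length `N` with first entry at most `c * k`, all of whose
quotients `⌊λ_i / i⌋` are divisible by `c`. -/
noncomputable def alhSet (c k N : ℕ) : Finset (ℕ → ℕ) := (alhSet_finite c k N).toFinset

theorem mem_alhSet {c k N : ℕ} {f : ℕ → ℕ} : f ∈ alhSet c k N ↔
    (∀ i, N ≤ i → f i = 0) ∧ (∀ i, (i + 1) * f (i + 1) ≤ (i + 2) * f i) ∧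
      f 0 ≤ c * k ∧ ∀ i, c ∣ f i / (i + 1) := by
  simp [alhSet]

theorem sum_tailSet (m r : ℕ) :
    ∑ h ∈ tailSet m r, (X ^ ∑ i ∈ range m, h i : ℤ[X]) = gaussBinom m r := by
  classical
  induction m generalizing r with
  | zero =>
    have : tailSet 0 r = {0} := by
      ext h
      simp only [mem_tailSet, mem_singleton, zero_le, true_implies]
      exact ⟨fun hh => funext hh.1, fun hh => by simp [hh]⟩
    simp [this]
  | succ m ihm =>
    induction r with
    | zero =>
      have : tailSet (m + 1) 0 = {0} := by
        ext h
        simp only [mem_tailSet, mem_singleton]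
        refine ⟨fun ⟨_, h1, h2⟩ => funext fun i => ?_, fun hh => by simp [hh]⟩
        exact Nat.le_zero.mp ((antitone_nat_of_succ_le h1 (Nat.zero_le i)).trans h2)
      simp [this]
    | succ r ihr =>
      let cons : (ℕ → ℕ) → ℕ → ℕ := fun h i => Nat.casesOn i (r + 1) h
      have hcons : Function.Injective cons := fun h h' e => funext fun i => congrFun e (i + 1)
      have hset : tailSet (m + 1) (r + 1) =
          tailSet (m + 1) r ∪ (tailSet m (r + 1)).image cons := by
        ext h
        simp only [mem_union, mem_image, mem_tailSet]
        constructor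
        · rintro ⟨h0, h1, h2⟩
          rcases Nat.le_succ_iff.mp h2 with h2 | h2
          · exact Or.inl ⟨h0, h1, h2⟩
          · refine Or.inr ⟨fun i => h (i + 1), ⟨fun i hi => h0 _ (by omega), fun i => h1 _, ?_⟩, ?_⟩
            · exact (h1 0).trans h2.le
            · funext i
              cases i
              · exact h2.symm
              · rfl
        · rintro (⟨h0, h1, h2⟩ | ⟨g, ⟨h0, h1, h2⟩, rfl⟩)
          · exact ⟨h0, h1, by omega⟩
          · refine ⟨fun i hi => ?_, fun i => ?_, le_rfl⟩
            · cases i with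
              | zero => omega
              | succ i => exact h0 i (by omega)
            · cases i with
              | zero => exact h2
              | succ i => exact h1 i
      have hdisj : Disjoint (tailSet (m + 1) r) ((tailSet m (r + 1)).image cons) := by
        rw [disjoint_left]
        intro h hh hh'
        obtain ⟨g, _, rfl⟩ := mem_image.mp hh'
        have : r + 1 ≤ r := (mem_tailSet.mp hh).2.2
        omega
      rw [hset, sum_union hdisj, ihr, sum_image hcons.injOn, gaussBinom_succ_succ, ← ihm, mul_sum]
      congr 1
      refine sum_congr rfl fun h _ => ?_
      rw [sum_range_succ', ← pow_add, add_comm]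
      rfl

/-- The composition with `r` quotients at least `c`, obtained from a composition `g` of length `r`
and a weakly decreasing sequence `h` of remainders. -/
def glue (c r : ℕ) (g h : ℕ → ℕ) (i : ℕ) : ℕ := if i < r then g i + c * (i + 1) else h (i - r)

theorem glue_mem {c k r m : ℕ} (hc : 0 < c) {g h : ℕ → ℕ} (hg : g ∈ alhSet c k r)
    (hh : h ∈ tailSet m r) : glue c r g h ∈ alhSet c (k + 1) (r + m) := by
  obtain ⟨g0, g1, g2, g3⟩ := mem_alhSet.mp hg
  obtain ⟨h0, h1, h2⟩ := mem_tailSet.mp hh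
  have hle (i : ℕ) : h i ≤ r := (antitone_nat_of_succ_le h1 (Nat.zero_le i)).trans h2
  refine mem_alhSet.mpr ⟨fun i hi => ?_, fun i => ?_, ?_, fun i => ?_⟩
  · rw [glue, if_neg (by omega), h0 _ (by omega)]
  · rcases lt_trichotomy (i + 1) r with hi | hi | hi
    · rw [glue, glue, if_pos hi, if_pos (by omega)]
      linarith [g1 i]
    · rw [glue, glue, if_neg (by omega), if_pos (by omega)]
      calc (i + 1) * h (i + 1 - r) ≤ (i + 1) * r := by gcongr; exact hle _
        _ ≤ (i + 2) * (c * (i + 1)) := by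
          rw [← hi]
          nlinarith [Nat.zero_le i, Nat.mul_le_mul hc (le_refl ((i + 2) * (i + 1)))]
        _ ≤ _ := by gcongr; omega
    · rw [glue, glue, if_neg (by omega), if_neg (by omega), show i + 1 - r = i - r + 1 by omega]
      exact Nat.mul_le_mul (by omega) (h1 _)
  · rw [glue]
    split_ifs with hr
    · linarith
    · exact (hle _).trans ((not_lt.mp hr).trans (Nat.zero_le _))
  · rw [glue]
    split_ifs with hr
    · rw [Nat.add_mul_div_right _ _ (Nat.succ_pos i)]
      exact dvd_add (g3 i) dvd_rfl
    · rw [Nat.div_eq_of_lt (by have := hle (i - r); omega)]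
      exact dvd_zero c

theorem sum_glue (c r m : ℕ) (g h : ℕ → ℕ) :
    ∑ i ∈ range (r + m), glue c r g h i =
      c * tri r + ∑ i ∈ range m, h i + ∑ i ∈ range r, g i := by
  rw [sum_range_add, tri, mul_sum]
  have h1 : ∑ i ∈ range r, glue c r g h i = ∑ i ∈ range r, (g i + c * (i + 1)) :=
    sum_congr rfl fun i hi => if_pos (mem_range.mp hi)
  have h2 : ∑ i ∈ range m, glue c r g h (r + i) = ∑ i ∈ range m, h i :=
    sum_congr rfl fun i _ => by rw [glue, if_neg (by omega), Nat.add_sub_cancel_left]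
  rw [h1, h2, sum_add_distrib]
  ring

theorem glue_inj {c k r r' m m' : ℕ} (hc : 0 < c) {g h g' h' : ℕ → ℕ}
    (hg : g ∈ alhSet c k r) (hh : h ∈ tailSet m r)
    (hg' : g' ∈ alhSet c k r') (hh' : h' ∈ tailSet m' r')
    (e : glue c r g h = glue c r' g' h') : r = r' ∧ g = g' ∧ h = h' := by
  have key {r r' m m' : ℕ} {g h g' h' : ℕ → ℕ} (hh : h ∈ tailSet m r)
      (e : glue c r g h = glue c r' g' h') : r' ≤ r := by
    obtain ⟨-, h1, h2⟩ := mem_tailSet.mp hh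
    by_contra! hr
    have := congrFun e r
    rw [glue, glue, if_neg (lt_irrefl r), if_pos hr, Nat.sub_self] at this
    nlinarith
  obtain rfl : r = r' := le_antisymm (key (m' := m) hh' e.symm) (key (m' := m) hh e)
  refine ⟨rfl, funext fun i => ?_, funext fun i => ?_⟩
  · rcases lt_or_ge i r with hi | hi
    · have := congrFun e i
      rw [glue, glue, if_pos hi, if_pos hi] at this
      exact Nat.add_right_cancel this
    · rw [(mem_alhSet.mp hg).1 i hi, (mem_alhSet.mp hg').1 i hi]
  · have := congrFun e (r + i)
    rwa [glue, glue, if_neg (by omega), if_neg (by omega), Nat.add_sub_cancel_left] at this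

theorem exists_glue {c k N : ℕ} {f : ℕ → ℕ} (hf : f ∈ alhSet c (k + 1) N) :
    ∃ r m, r + m = N ∧ ∃ g ∈ alhSet c k r, ∃ h ∈ tailSet m r, glue c r g h = f := by
  obtain ⟨f0, f1, f2, f3⟩ := mem_alhSet.mp hf
  have hex : ∃ r, f r ≤ r := ⟨N, by simp [f0 N le_rfl]⟩
  obtain ⟨r, hr, hmin⟩ : ∃ r, f r ≤ r ∧ ∀ i < r, i < f i :=
    ⟨Nat.find hex, Nat.find_spec hex, fun i hi => not_le.mp (Nat.find_min hex hi)⟩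
  have hrN : r ≤ N := by
    by_contra! h
    have := hmin N h
    simp [f0 N le_rfl] at this
  have hbig (i : ℕ) (hi : i < r) : c * (i + 1) ≤ f i := by
    have h1 : 0 < f i / (i + 1) := Nat.div_pos (hmin i hi) (Nat.succ_pos i)
    exact (Nat.mul_le_mul_right _ (Nat.le_of_dvd h1 (f3 i))).trans (Nat.div_mul_le_self _ _)
  have hstep (i : ℕ) (hi : f i ≤ i) : f (i + 1) ≤ f i := by
    by_contra! h
    nlinarith [f1 i, Nat.mul_le_mul_left (i + 1) (Nat.succ_le_of_lt h)]
  have hsmall (i : ℕ) : f (r + i) ≤ r + i := by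
    induction i with
    | zero => exact hr
    | succ i ih => exact (hstep _ ih).trans (by omega)
  refine ⟨r, N - r, by omega, fun i => if i < r then f i - c * (i + 1) else 0, ?_,
    fun i => f (r + i), ?_, ?_⟩
  · refine mem_alhSet.mpr ⟨fun i hi => if_neg (by omega), fun i => ?_, ?_, fun i => ?_⟩
    · rcases lt_or_ge (i + 1) r with hi | hi
      · rw [if_pos hi, if_pos (by omega)]
        have h1 := hbig i (by omega)
        have h2 := hbig (i + 1) hi
        zify [h1, h2]
        have h3 : ((i + 1) * f (i + 1) : ℤ) ≤ (i + 2) * f i := mod_cast f1 i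
        linarith
      · rw [if_neg (by omega)]; simp
    · split_ifs with h
      · rw [mul_add] at f2; omega
      · exact Nat.zero_le _
    · split_ifs with h
      · rw [mul_comm, Nat.sub_mul_div]
        exact Nat.dvd_sub (f3 i) dvd_rfl
      · simp
  · refine mem_tailSet.mpr ⟨fun i hi => f0 _ (by omega), fun i => hstep _ (hsmall i), hr⟩
  · funext i
    rw [glue]
    split_ifs with h
    · exact Nat.sub_add_cancel (hbig i h)
    · rw [Nat.add_sub_cancel' (not_lt.mp h)]

theorem sum_alhSet {c : ℕ} (hc : 0 < c) (k N : ℕ) :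
    ∑ f ∈ alhSet c k N, (X ^ ∑ i ∈ range N, f i : ℤ[X]) = chainGF c k N := by
  induction k generalizing N with
  | zero =>
    have : alhSet c 0 N = {0} := by
      ext f
      simp only [mem_alhSet, mem_singleton]
      refine ⟨fun ⟨_, h1, h2, _⟩ => funext fun i => ?_, fun hh => by simp [hh]⟩
      have := le_of_anti_lecture h1 i
      simpa [Nat.le_zero.mp h2] using this
    simp [this, chainGF]
  | succ k ih =>
    have hterm (p : ℕ × ℕ) : X ^ (c * tri p.1) * gaussBinom p.2 p.1 * chainGF c k p.1 =
        ∑ u ∈ alhSet c k p.1 ×ˢ tailSet p.2 p.1,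
          (X ^ ∑ i ∈ range (p.1 + p.2), glue c p.1 u.1 u.2 i : ℤ[X]) := by
      rw [← ih, ← sum_tailSet, mul_assoc, mul_comm (∑ h ∈ tailSet _ _, _), sum_mul_sum, mul_sum,
        sum_product]
      refine sum_congr rfl fun g _ => ?_
      rw [mul_sum]
      refine sum_congr rfl fun h _ => ?_
      rw [sum_glue, pow_add, pow_add]
      ring
    rw [chainGF_succ, sum_congr rfl fun p _ => hterm p, sum_sigma']
    symm
    refine sum_bij (fun x _ => glue c x.1.1 x.2.1 x.2.2) ?_ ?_ ?_ ?_
    · rintro ⟨⟨r, m⟩, ⟨g, h⟩⟩ hx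
      simp only [mem_sigma, HasAntidiagonal.mem_antidiagonal, mem_product] at hx
      rw [← hx.1]
      exact glue_mem hc hx.2.1 hx.2.2
    · rintro ⟨⟨r, m⟩, ⟨g, h⟩⟩ hx ⟨⟨r', m'⟩, ⟨g', h'⟩⟩ hx' e
      simp only [mem_sigma, HasAntidiagonal.mem_antidiagonal, mem_product] at hx hx'
      obtain ⟨rfl, rfl, rfl⟩ := glue_inj hc hx.2.1 hx.2.2 hx'.2.1 hx'.2.2 e
      obtain rfl : m = m' := by omega
      rfl
    · intro f hf
      obtain ⟨r, m, e, g, hg, h, hh, rfl⟩ := exists_glue hf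
      exact ⟨⟨(r, m), (g, h)⟩, by simp [e, hg, hh], rfl⟩
    · rintro ⟨⟨r, m⟩, ⟨g, h⟩⟩ hx
      simp only [mem_sigma, HasAntidiagonal.mem_antidiagonal] at hx
      rw [← hx.1]

theorem IsALH.apply_eq_zero {f : ℕ → ℕ} (hf : IsALH f) {i : ℕ} (hi : wt f ≤ i) : f i = 0 := by
  by_contra h
  have hpos (j : ℕ) (hj : j ≤ i) : 1 ≤ f j := by
    induction hj using Nat.decreasingInduction with
    | self => omega
    | of_succ j _ ih =>
      by_contra! h0
      have := hf.2 j
      rw [Nat.lt_one_iff.mp h0] at this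
      nlinarith
  have h1 : ∑ j ∈ range (i + 1), f j ≤ wt f := by
    rw [wt, finsum_eq_sum f hf.1]
    refine sum_le_sum_of_ne_zero fun j _ hj => by simpa using hj
  have h2 : ∑ j ∈ range (i + 1), 1 ≤ ∑ j ∈ range (i + 1), f j :=
    sum_le_sum fun j hj => hpos j (by rw [mem_range] at hj; omega)
  simp at h2
  omega

theorem wt_eq_sum_range {f : ℕ → ℕ} {N : ℕ} (h : ∀ i, N ≤ i → f i = 0) :
    wt f = ∑ i ∈ range N, f i :=
  finsum_eq_sum_of_support_subset f fun i hi => by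
    by_contra hn
    exact hi (h i (by simpa using hn))

theorem ncard_eq_coeff_chainGF {c : ℕ} (hc : 0 < c) (k : ℕ) {n N : ℕ} (h : n ≤ N) :
    ({f | IsALH f ∧ f 0 ≤ c * k ∧ (∀ i, c ∣ f i / (i + 1)) ∧ wt f = n}.ncard : ℤ) =
      (chainGF c k N).coeff n := by
  rw [← sum_alhSet hc, finsetSum_coeff]
  simp only [coeff_X_pow]
  rw [sum_boole, Nat.cast_inj, ← Set.ncard_coe_finset]
  congr 1
  ext f
  simp only [Set.mem_ofPred_eq, coe_filter, mem_alhSet]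
  constructor
  · rintro ⟨h1, h2, h3, h4⟩
    have h0 (i : ℕ) (hi : N ≤ i) : f i = 0 := h1.apply_eq_zero (by omega)
    exact ⟨⟨h0, h1.2, h2, h3⟩, by rw [← wt_eq_sum_range h0, h4]⟩
  · rintro ⟨⟨h0, h1, h2, h3⟩, h4⟩
    refine ⟨⟨(Set.finite_lt_nat N).subset fun i hi => ?_, h1⟩, h2, h3, ?_⟩
    · by_contra hn
      exact hi (h0 i (by simpa using hn))
    · rw [wt_eq_sum_range h0, h4]

theorem ncard_Fset {k n N : ℕ} (h : n ≤ N) : ((Fset k n).ncard : ℤ) = (chainGF 1 k N).coeff n := by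
  rw [← ncard_eq_coeff_chainGF one_pos k h]
  simp [Fset]

theorem ncard_Qset {k n N : ℕ} (h : n ≤ N) :
    ((Qset (2 * k) n).ncard : ℤ) = (chainGF 2 k N).coeff n := by
  rw [← ncard_eq_coeff_chainGF two_pos k h]
  simp only [Qset, even_iff_two_dvd]

/-- For `k ≥ 2` and `n ≥ 0`,
`|F_{2k-1}(n)| = Σ_{j=0}^n d(j) · |Q_{2k-2}(n-j)|`, where `d(j)` is the number of
partitions of `j` into distinct parts. -/
theorem alh_convolution (k n : ℕ) (hk : 2 ≤ k) :
    (Fset (2 * k - 1) n).ncard =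
      ∑ j ∈ Finset.range (n + 1),
        (Nat.Partition.distincts j).card * (Qset (2 * k - 2) (n - j)).ncard := by
  obtain ⟨k, rfl⟩ : ∃ l, k = l + 1 := ⟨k - 1, by omega⟩
  rw [show 2 * (k + 1) - 1 = 2 * k + 1 by omega, show 2 * (k + 1) - 2 = 2 * k by omega]
  zify
  rw [ncard_Fset le_rfl, chainGF_one_eq, coeff_mul, Nat.sum_antidiagonal_eq_sum_range_succ_mk]
  refine sum_congr rfl fun j hj => ?_
  rw [coeff_distinctGF (by rw [mem_range] at hj; omega), ncard_Qset (Nat.sub_le n j)]
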